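/- Let μ be a probability measure on ℝ and α ∈ ℝ. Let s_α : ℝ → ℝ denote the scaling map t ↦ αt. Then the El Gordo transform commutes with scaling: ((s_α)_*μ)^♭ = (s_α)_*(μ^♭), where (s_α)_*μ denotes the pushforward of μ under s_α. -/

import Mathlib

open MeasureTheory Complex

/-- The Cauchy transform of a measure on ℝ. -/
noncomputable def cauchy (μ : Measure ℝ) (z : ℂ) : ℂ := ∫ t, (z - (t : ℂ))⁻¹ ∂μ

open Filter Topology BoundedContinuousFunction in
theorem poisson_tendsto (ρ : Measure ℝ) [IsProbabilityMeasure ρ] (f : ℝ →ᵇ ℝ) :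
    Tendsto (fun y : ℝ => ∫ t, (∫ u, f (t + y * u) * (1 + u ^ 2)⁻¹) ∂ρ) (𝓝[>] 0)
      (𝓝 (Real.pi * ∫ t, f t ∂ρ)) := by
  have e : Real.pi * ∫ t, f t ∂ρ = ∫ t, (∫ u : ℝ, f t * (1 + u ^ 2)⁻¹) ∂ρ := by
    simp_rw [integral_const_mul, integral_univ_inv_one_add_sq, integral_mul_const]
    ring
  rw [e]
  have hb : ∀ t y u : ℝ, ‖f (t + y * u) * (1 + u ^ 2)⁻¹‖ ≤ ‖f‖ * (1 + u ^ 2)⁻¹ := by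
    intro t y u
    rw [norm_mul, Real.norm_of_nonneg (by positivity : (0:ℝ) ≤ (1 + u ^ 2)⁻¹)]
    gcongr
    exact f.norm_coe_le_norm _
  have hi : Integrable (fun u : ℝ => ‖f‖ * (1 + u ^ 2)⁻¹) :=
    integrable_inv_one_add_sq.const_mul _
  have hc : Continuous (fun p : ℝ × ℝ × ℝ => f (p.1 + p.2.1 * p.2.2) * (1 + p.2.2 ^ 2)⁻¹) := by
    refine (f.continuous.comp (by fun_prop)).mul (Continuous.inv₀ (by fun_prop) ?_)
    intro p
    positivity
  refine tendsto_integral_filter_of_dominated_convergence (fun _ => ‖f‖ * Real.pi) ?_ ?_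
    (integrable_const _) ?_
  · refine Eventually.of_forall fun y => ?_
    have : StronglyMeasurable (fun p : ℝ × ℝ => f (p.1 + y * p.2) * (1 + p.2 ^ 2)⁻¹) :=
      (hc.comp (by fun_prop : Continuous fun p : ℝ × ℝ => (p.1, y, p.2))).stronglyMeasurable
    exact this.integral_prod_right'.aestronglyMeasurable
  · refine Eventually.of_forall fun y => Eventually.of_forall fun t => ?_
    refine (norm_integral_le_of_norm_le hi (Eventually.of_forall (hb t y))).trans ?_
    rw [integral_const_mul, integral_univ_inv_one_add_sq]
  · refine Eventually.of_forall fun t => ?_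
    refine tendsto_integral_filter_of_dominated_convergence _ ?_ ?_ hi ?_
    · refine Eventually.of_forall fun y => ?_
      exact (hc.comp (by fun_prop : Continuous fun u : ℝ => (t, y, u))).aestronglyMeasurable
    · exact Eventually.of_forall fun y => Eventually.of_forall (hb t y)
    · refine Eventually.of_forall fun u => ?_
      have h := (hc.comp (by fun_prop : Continuous fun y : ℝ => (t, y, u))).tendsto 0
      simp only [Function.comp_def, zero_mul, add_zero] at h
      exact h.mono_left nhdsWithin_le_nhds

theorem cauchy_kernel_im (z : ℂ) (t : ℝ) :
    ((z - (t : ℂ))⁻¹).im = - (z.im / ((z.re - t) ^ 2 + z.im ^ 2)) := by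
  rw [inv_im, normSq_apply]
  simp
  ring

theorem cauchy_integrable (ρ : Measure ℝ) [IsProbabilityMeasure ρ] (z : ℂ) (hz : 0 < z.im) :
    Integrable (fun t : ℝ => (z - (t : ℂ))⁻¹) ρ := by
  refine Integrable.of_bound (C := z.im⁻¹) ?_ (Filter.Eventually.of_forall fun t => ?_)
  · refine Continuous.aestronglyMeasurable (Continuous.inv₀ (by fun_prop) ?_)
    intro t h
    have := congrArg Complex.im h
    simp at this
    exact hz.ne' this
  · rw [norm_inv]
    gcongr
    have := Complex.abs_im_le_norm (z - t)
    simp at this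
    exact (le_abs_self _).trans this

theorem cauchy_im (ρ : Measure ℝ) [IsProbabilityMeasure ρ] (z : ℂ) (hz : 0 < z.im) :
    (cauchy ρ z).im = - ∫ t, z.im / ((z.re - t) ^ 2 + z.im ^ 2) ∂ρ := by
  have := integral_im (cauchy_integrable ρ z hz)
  simp only [RCLike.im_eq_complex_im] at this
  rw [cauchy, ← this]
  simp_rw [cauchy_kernel_im]
  rw [integral_neg]

theorem cauchy_im_neg (ρ : Measure ℝ) [IsProbabilityMeasure ρ] (z : ℂ) (hz : 0 < z.im) :
    (cauchy ρ z).im < 0 := by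
  rw [cauchy_im ρ z hz, neg_lt_zero]
  have hi := (cauchy_integrable ρ z hz).im.neg
  have hi' : Integrable (fun t => z.im / ((z.re - t) ^ 2 + z.im ^ 2)) ρ := by
    refine hi.congr (Filter.Eventually.of_forall fun t => ?_)
    simp only [Pi.neg_apply, RCLike.im_eq_complex_im, cauchy_kernel_im, neg_neg]
  have hp : ∀ t : ℝ, 0 < z.im / ((z.re - t) ^ 2 + z.im ^ 2) := fun t => by positivity
  rw [integral_pos_iff_support_of_nonneg (fun t => (hp t).le) hi']
  have : Function.support (fun t => z.im / ((z.re - t) ^ 2 + z.im ^ 2)) = Set.univ := by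
    ext t; simpa using (hp t).ne'
  rw [this]; simp

open BoundedContinuousFunction in
theorem poisson_eq (ρ : Measure ℝ) [IsProbabilityMeasure ρ] (f : ℝ →ᵇ ℝ) (y : ℝ) (hy : 0 < y) :
    ∫ t, (∫ u, f (t + y * u) * (1 + u ^ 2)⁻¹) ∂ρ =
      ∫ x : ℝ, f x * -(cauchy ρ ⟨x, y⟩).im := by
  have h1 : ∀ t : ℝ, ∫ u, f (t + y * u) * (1 + u ^ 2)⁻¹ =
      ∫ x, f x * (y / ((x - t) ^ 2 + y ^ 2)) := by
    intro t
    have a := Measure.integral_comp_mul_left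
      (fun x => f (t + x) * (y * (y / (x ^ 2 + y ^ 2)))) y
    have b := integral_add_left_eq_self (μ := volume)
      (fun x => f x * (y / ((x - t) ^ 2 + y ^ 2))) t
    rw [← b]
    simp only [add_sub_cancel_left]
    calc _ = ∫ x, f (t + y * x) * (y * (y / ((y * x) ^ 2 + y ^ 2))) := by
          congr 1; ext u; congr 1; field_simp; ring
      _ = _ := by
          rw [a, abs_of_pos (inv_pos.2 hy), ← integral_smul]
          congr 1; ext u; simp only [smul_eq_mul]; field_simp
  simp_rw [h1]
  have hk : Integrable (fun x : ℝ => y / (x ^ 2 + y ^ 2)) := by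
    have := (integrable_inv_one_add_sq.comp_div hy.ne').const_mul y⁻¹
    refine this.congr (Filter.Eventually.of_forall fun x => ?_)
    simp only
    field_simp
    ring
  have hcont : Continuous (fun p : ℝ × ℝ => y / ((p.2 - p.1) ^ 2 + y ^ 2)) := by
    refine Continuous.div (by fun_prop) (by fun_prop) fun p => ?_
    positivity
  have hp : Integrable (fun p : ℝ × ℝ => y / ((p.2 - p.1) ^ 2 + y ^ 2)) (ρ.prod volume) := by
    rw [integrable_prod_iff hcont.aestronglyMeasurable]
    refine ⟨Filter.Eventually.of_forall fun t => hk.comp_sub_right t, ?_⟩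
    have : ∀ t : ℝ, ∫ x, ‖y / ((x - t) ^ 2 + y ^ 2)‖ = ∫ x, ‖y / (x ^ 2 + y ^ 2)‖ := fun t =>
      integral_sub_right_eq_self (fun x => ‖y / (x ^ 2 + y ^ 2)‖) t
    simp only [this]
    exact integrable_const _
  rw [integral_integral_swap]
  · congr 1; ext x
    rw [integral_const_mul, cauchy_im ρ _ hy, neg_neg]
  · refine hp.bdd_mul (c := ‖f‖) (f.continuous.comp continuous_snd).aestronglyMeasurable
      (Filter.Eventually.of_forall fun p => f.norm_coe_le_norm _)

theorem cauchy_unique (ρ ν : Measure ℝ) [IsProbabilityMeasure ρ] [IsProbabilityMeasure ν]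
    (h : ∀ z : ℂ, 0 < z.im → cauchy ρ z = cauchy ν z) : ρ = ν := by
  refine ext_of_forall_integral_eq_of_IsFiniteMeasure fun f => ?_
  have a := poisson_tendsto ρ f
  have b := poisson_tendsto ν f
  have c := tendsto_nhds_unique_of_eventuallyEq a b (by
    filter_upwards [self_mem_nhdsWithin] with y hy
    have hy : 0 < y := hy
    rw [poisson_eq ρ f y hy, poisson_eq ν f y hy]
    congr 1; ext x
    rw [h ⟨x, y⟩ hy])
  exact mul_left_cancel₀ Real.pi_ne_zero c

theorem cauchy_map (ρ : Measure ℝ) [IsProbabilityMeasure ρ] (α : ℝ) (z : ℂ) (hz : 0 < z.im) :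
    cauchy (Measure.map (fun t => α * t) ρ) z = ∫ t, (z - ((α * t : ℝ) : ℂ))⁻¹ ∂ρ := by
  have : IsProbabilityMeasure (Measure.map (fun t => α * t) ρ) :=
    Measure.isProbabilityMeasure_map (by fun_prop)
  rw [cauchy, integral_map (by fun_prop)]
  exact (cauchy_integrable _ z hz).aestronglyMeasurable

theorem cauchy_map' (ρ : Measure ℝ) [IsProbabilityMeasure ρ] (α : ℝ) (hα : α ≠ 0)
    (z : ℂ) (hz : 0 < z.im) :
    cauchy (Measure.map (fun t => α * t) ρ) z = (α : ℂ)⁻¹ * cauchy ρ (z / α) := by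
  rw [cauchy_map ρ α z hz, cauchy, ← integral_const_mul]
  congr 1; ext t
  have : (α : ℂ) ≠ 0 := by exact_mod_cast hα
  rw [← mul_inv]
  congr 1
  push_cast
  field_simp

theorem cauchy_conj (ρ : Measure ℝ) (z : ℂ) :
    cauchy ρ (starRingEnd ℂ z) = starRingEnd ℂ (cauchy ρ z) := by
  rw [cauchy, cauchy, ← integral_conj]
  simp

/-- the El Gordo transform commutes with scaling.  Here ρ₁ is the
El Gordo transform of the pushforward (s_α)_*μ and ρ₂ is the El Gordo transform of μ
(each characterized by its defining Cauchy-transform equation); the conclusion is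
ρ₁ = (s_α)_* ρ₂. -/
theorem elGordo_scaling (μ ρ₁ ρ₂ : Measure ℝ)
    [IsProbabilityMeasure μ] [IsProbabilityMeasure ρ₁] [IsProbabilityMeasure ρ₂]
    (α : ℝ)
    (h₁ : ∀ z : ℂ, 0 < z.im →
      (cauchy ρ₁ z) ^ 2 = cauchy (Measure.map (fun t => α * t) μ) z / z)
    (h₂ : ∀ z : ℂ, 0 < z.im → (cauchy ρ₂ z) ^ 2 = cauchy μ z / z) :
    ρ₁ = Measure.map (fun t => α * t) ρ₂ := by
  have : IsProbabilityMeasure (Measure.map (fun t => α * t) ρ₂) :=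
    Measure.isProbabilityMeasure_map (by fun_prop)
  refine cauchy_unique _ _ fun z hz => ?_
  have hsq : (cauchy ρ₁ z) ^ 2 = (cauchy (Measure.map (fun t => α * t) ρ₂) z) ^ 2 := by
    rw [h₁ z hz]
    by_cases hα : α = 0
    · subst hα
      rw [cauchy_map _ _ _ hz, cauchy_map _ _ _ hz]
      simp
      ring
    · have h₂' : (cauchy ρ₂ (z / α)) ^ 2 = cauchy μ (z / α) / (z / α) := by
        rcases lt_or_gt_of_ne hα with h | h
        · have := h₂ (starRingEnd ℂ (z / α)) (by
            rw [conj_im, div_ofReal_im, neg_pos]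
            exact div_neg_of_pos_of_neg hz h)
          rw [cauchy_conj, cauchy_conj, ← map_pow, ← map_div₀] at this
          exact (starRingEnd ℂ).injective this
        · exact h₂ _ (by rw [div_ofReal_im]; positivity)
      rw [cauchy_map' _ _ hα _ hz, cauchy_map' _ _ hα _ hz, mul_pow, h₂']
      have : (α : ℂ) ≠ 0 := by exact_mod_cast hα
      have : z ≠ 0 := by rintro rfl; simp at hz
      field_simp
  rcases sq_eq_sq_iff_eq_or_eq_neg.1 hsq with h | h
  · exact h
  · have a := cauchy_im_neg ρ₁ z hz
    have b := cauchy_im_neg (Measure.map (fun t => α * t) ρ₂) z hz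
    rw [h, neg_im] at a
    linarith
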